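/- For every κ > 0, every f ∈ L¹(μ_κ) and all s, y ∈ ℝ, the Dunkl transform of the generalized translation satisfies (τ_s f)^(y) = E(s, −iy) · f̂(y); that is, the explicit integral formula for τ_s realizes multiplication by the Dunkl kernel E(s,−iy) on the transform side. -/

import Mathlib

open MeasureTheory Real Filter Topology

/-- The weighted measure `dμ_κ(t) = |t|^{2κ} dt` on `ℝ`. -/
noncomputable def mu (κ : ℝ) : Measure ℝ :=
  MeasureTheory.volume.withDensity (fun t => ENNReal.ofReal (|t| ^ (2 * κ)))

/-- The normalizing constant `b_κ = Γ(κ+1/2)/(√π Γ(κ))`. -/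
noncomputable def bk (κ : ℝ) : ℝ := Real.Gamma (κ + 1 / 2) / (Real.sqrt π * Real.Gamma κ)

/-- The density `Φ_κ(u) = b_κ (1+u)(1-u²)^{κ-1}`. -/
noncomputable def Phi (κ u : ℝ) : ℝ := bk κ * (1 + u) * (1 - u ^ 2) ^ (κ - 1)

/-- The generalized (Dunkl) translation operator `τ_s` for the group `ℤ₂` on `ℝ`. -/
noncomputable def tau (κ s : ℝ) (f : ℝ → ℂ) (t : ℝ) : ℂ :=
  (1 / 2 : ℂ) * ∫ u in Set.Ioo (-1 : ℝ) 1,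
    (f (Real.sqrt (t ^ 2 + s ^ 2 - 2 * s * t * u)) *
        ((1 + (t - s) / Real.sqrt (t ^ 2 + s ^ 2 - 2 * s * t * u) : ℝ) : ℂ) +
      f (-Real.sqrt (t ^ 2 + s ^ 2 - 2 * s * t * u)) *
        ((1 - (t - s) / Real.sqrt (t ^ 2 + s ^ 2 - 2 * s * t * u) : ℝ) : ℂ)) *
    ((Phi κ u : ℝ) : ℂ)

/-- The one-dimensional Dunkl kernel `E(z,w)` for the reflection group `ℤ₂`. -/
noncomputable def Ek (κ : ℝ) (z w : ℂ) : ℂ :=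
  (bk κ : ℂ) * ∫ u in Set.Ioo (-1 : ℝ) 1,
    Complex.exp (z * w * (u : ℂ)) * (((1 + u) * (1 - u ^ 2) ^ (κ - 1) : ℝ) : ℂ)

/-- The constant `c_κ` with `c_κ⁻¹ = ∫ e^{-x²/2} dμ_κ(x)`. -/
noncomputable def ck (κ : ℝ) : ℝ := (∫ x, Real.exp (-x ^ 2 / 2) ∂(mu κ))⁻¹

/-- The Dunkl transform `f̂(y) = c_κ ∫ f(x) E(x,-iy) dμ_κ(x)`. -/
noncomputable def dunkl (κ : ℝ) (f : ℝ → ℂ) (y : ℝ) : ℂ :=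
  (ck κ : ℂ) * ∫ x, f x * Ek κ (x : ℂ) (-Complex.I * (y : ℂ)) ∂(mu κ)

open Finset.HasAntidiagonal (antidiagonal)

/-- The Dunkl integers `[n]`: `n` for even `n` and `n + 2κ` for odd `n`. -/
noncomputable def dunklNat (κ : ℝ) (n : ℕ) : ℝ := n + κ * (1 - (-1) ^ n)

/-- The Dunkl factorial `γ_n = [1][2]⋯[n]`. -/
noncomputable def dunklFactorial (κ : ℝ) : ℕ → ℝ
  | 0 => 1
  | n + 1 => dunklNat κ (n + 1) * dunklFactorial κ n

/-- The weight `(1 - u²)^{κ-1}`. -/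
noncomputable def gegenbauerWeight (κ u : ℝ) : ℝ := (1 - u ^ 2) ^ (κ - 1)

section DunklFactorial

variable {κ : ℝ}

lemma dunklNat_two_mul (m : ℕ) : dunklNat κ (2 * m) = 2 * m := by
  simp [dunklNat, pow_mul]

lemma dunklNat_two_mul_add_one (m : ℕ) : dunklNat κ (2 * m + 1) = 2 * m + 1 + 2 * κ := by
  simp [dunklNat, pow_mul, pow_succ]; ring

lemma cast_le_dunklNat (hκ : 0 < κ) (n : ℕ) : (n : ℝ) ≤ dunklNat κ n := by
  obtain h | h := neg_one_pow_eq_or ℝ n <;> simp only [dunklNat, h] <;> nlinarith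

lemma factorial_le_dunklFactorial (hκ : 0 < κ) (n : ℕ) :
    (n.factorial : ℝ) ≤ dunklFactorial κ n := by
  induction n with
  | zero => simp [dunklFactorial]
  | succ n ih =>
    rw [Nat.factorial_succ, dunklFactorial, Nat.cast_mul]
    exact mul_le_mul (cast_le_dunklNat hκ _) ih (by positivity)
      ((Nat.cast_nonneg _).trans (cast_le_dunklNat hκ _))

lemma dunklFactorial_pos (hκ : 0 < κ) (n : ℕ) : 0 < dunklFactorial κ n :=
  lt_of_lt_of_le (by exact_mod_cast n.factorial_pos) (factorial_le_dunklFactorial hκ n)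

/-- The normalized monomials `x^n / γ_n`. -/
noncomputable def dunklMonomial (κ x : ℝ) (n : ℕ) : ℝ := x ^ n / dunklFactorial κ n

lemma mul_dunklMonomial (hκ : 0 < κ) (x : ℝ) (n : ℕ) :
    x * dunklMonomial κ x n = dunklNat κ (n + 1) * dunklMonomial κ x (n + 1) := by
  have h1 := dunklFactorial_pos hκ n
  have h2 : 0 < dunklNat κ (n + 1) :=
    lt_of_lt_of_le (by positivity) (cast_le_dunklNat hκ (n + 1))
  simp only [dunklMonomial, dunklFactorial]
  field_simp
  ring

lemma sum_antidiagonal_shift_left (g : ℕ → ℕ → ℝ) (hg : ∀ j, g 0 j = 0) (n : ℕ) :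
    ∑ p ∈ antidiagonal n, g (p.1 + 1) p.2 = ∑ p ∈ antidiagonal (n + 1), g p.1 p.2 := by
  rw [Finset.Nat.sum_antidiagonal_succ]; simp [hg]

lemma sum_antidiagonal_shift_right (g : ℕ → ℕ → ℝ) (hg : ∀ i, g i 0 = 0) (n : ℕ) :
    ∑ p ∈ antidiagonal n, g p.1 (p.2 + 1) = ∑ p ∈ antidiagonal (n + 1), g p.1 p.2 := by
  rw [Finset.Nat.sum_antidiagonal_succ']; simp [hg]

/-- The part of `∑ t^i s^j / (γ_i γ_j)`, `i + j = n`, with `i` even (`ε = 1`) or odd (`ε = -1`). -/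
noncomputable def binomialPart (κ t s ε : ℝ) (n : ℕ) : ℝ :=
  ∑ p ∈ antidiagonal n,
    (1 + ε * (-1) ^ p.1) / 2 * (dunklMonomial κ t p.1 * dunklMonomial κ s p.2)

lemma binomialPart_one_add (t s : ℝ) (n : ℕ) :
    binomialPart κ t s 1 n + binomialPart κ t s (-1) n =
      ∑ p ∈ antidiagonal n, dunklMonomial κ t p.1 * dunklMonomial κ s p.2 := by
  simp only [binomialPart, ← Finset.sum_add_distrib]
  exact Finset.sum_congr rfl fun p _ => by ring

lemma add_mul_sum_dunklMonomial (hκ : 0 < κ) (t s : ℝ) (m : ℕ) :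
    (t + s) * ∑ p ∈ antidiagonal (2 * m), dunklMonomial κ t p.1 * dunklMonomial κ s p.2 =
      dunklNat κ (2 * m + 1) * ∑ p ∈ antidiagonal (2 * m + 1),
        dunklMonomial κ t p.1 * dunklMonomial κ s p.2 := by
  have h1 := sum_antidiagonal_shift_left
    (fun i j => dunklNat κ i * (dunklMonomial κ t i * dunklMonomial κ s j))
    (fun j => by simp [dunklNat]) (2 * m)
  have h2 := sum_antidiagonal_shift_right
    (fun i j => dunklNat κ j * (dunklMonomial κ t i * dunklMonomial κ s j))
    (fun j => by simp [dunklNat]) (2 * m)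
  calc _ = ∑ p ∈ antidiagonal (2 * m), dunklNat κ (p.1 + 1) *
              (dunklMonomial κ t (p.1 + 1) * dunklMonomial κ s p.2) +
            ∑ p ∈ antidiagonal (2 * m), dunklNat κ (p.2 + 1) *
              (dunklMonomial κ t p.1 * dunklMonomial κ s (p.2 + 1)) := by
        rw [Finset.mul_sum, ← Finset.sum_add_distrib]
        refine Finset.sum_congr rfl fun p _ => ?_
        linear_combination dunklMonomial κ s p.2 * mul_dunklMonomial hκ t p.1 +
          dunklMonomial κ t p.1 * mul_dunklMonomial hκ s p.2
    _ = _ := by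
        rw [h1, h2, ← Finset.sum_add_distrib, Finset.mul_sum]
        refine Finset.sum_congr rfl fun p hp => ?_
        rw [← add_mul]
        congr 1
        have hp' : p.1 + p.2 = 2 * m + 1 := Finset.HasAntidiagonal.mem_antidiagonal.mp hp
        obtain ⟨k, hk | hk⟩ := Nat.even_or_odd' p.1
        · obtain ⟨l, hl⟩ : ∃ l, p.2 = 2 * l + 1 := ⟨m - k, by omega⟩
          have : k + l = m := by omega
          rw [hk, hl, dunklNat_two_mul, dunklNat_two_mul_add_one, dunklNat_two_mul_add_one, ← this]
          push_cast; ring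
        · obtain ⟨l, hl⟩ : ∃ l, p.2 = 2 * l := ⟨m - k, by omega⟩
          have : k + l = m := by omega
          rw [hk, hl, dunklNat_two_mul, dunklNat_two_mul_add_one, dunklNat_two_mul_add_one, ← this]
          push_cast; ring

lemma neg_one_pow_mul_self (i : ℕ) : ((-1 : ℝ) ^ i) * (-1) ^ i = 1 := by
  rw [← mul_pow]; simp

/-- Multiplication by `t² + s²` and by `2ts` in terms of normalized monomials. -/
lemma sq_add_sq_mul_binomialPart (hκ : 0 < κ) (t s ε : ℝ) (hε : ε * ε = 1) (m : ℕ) :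
    (t ^ 2 + s ^ 2) * binomialPart κ t s ε (2 * m) + 2 * s * t * binomialPart κ t s (-ε) (2 * m) =
      (2 * m + 1 + 2 * κ) * (2 * (m + 1) + (1 - ε) * 2 * κ) * binomialPart κ t s ε (2 * m + 2) := by
  set G : ℕ → ℕ → ℝ := fun i j =>
    (1 + ε * (-1) ^ i) / 2 * (dunklMonomial κ t i * dunklMonomial κ s j)
  set d : ℕ → ℝ := fun i => dunklNat κ i * ((i : ℝ) - 1 + κ * (1 + (-1) ^ i)) with hd
  have hd0 : d 0 = 0 := by simp [hd, dunklNat]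
  have hd1 : d 1 = 0 := by simp [hd, dunklNat]
  have hd2 : ∀ i, d (i + 2) = dunklNat κ (i + 1) * dunklNat κ (i + 2) := fun i => by
    simp only [hd, dunklNat, pow_add]; push_cast; ring
  have hsq : ∀ x i, x ^ 2 * dunklMonomial κ x i = d (i + 2) * dunklMonomial κ x (i + 2) := by
    intro x i
    rw [hd2]
    linear_combination x * mul_dunklMonomial hκ x i +
      dunklNat κ (i + 1) * mul_dunklMonomial hκ x (i + 1)
  have h1 : t ^ 2 * binomialPart κ t s ε (2 * m) =
      ∑ p ∈ antidiagonal (2 * m + 2), d p.1 * G p.1 p.2 := by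
    rw [← sum_antidiagonal_shift_left (fun i j => d i * G i j) (by simp [hd0]),
      ← sum_antidiagonal_shift_left (fun i j => d (i + 1) * G (i + 1) j) (by simp [hd1]),
      binomialPart, Finset.mul_sum]
    refine Finset.sum_congr rfl fun p _ => ?_
    simp only [G, pow_succ]
    linear_combination (1 + ε * (-1) ^ p.1) / 2 * dunklMonomial κ s p.2 * hsq t p.1
  have h2 : s ^ 2 * binomialPart κ t s ε (2 * m) =
      ∑ p ∈ antidiagonal (2 * m + 2), d p.2 * G p.1 p.2 := by
    rw [← sum_antidiagonal_shift_right (fun i j => d j * G i j) (by simp [hd0]),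
      ← sum_antidiagonal_shift_right (fun i j => d (j + 1) * G i (j + 1)) (by simp [hd1]),
      binomialPart, Finset.mul_sum]
    refine Finset.sum_congr rfl fun p _ => ?_
    simp only [G]
    linear_combination (1 + ε * (-1) ^ p.1) / 2 * dunklMonomial κ t p.1 * hsq s p.2
  have h3 : s * t * binomialPart κ t s (-ε) (2 * m) =
      ∑ p ∈ antidiagonal (2 * m + 2), dunklNat κ p.1 * dunklNat κ p.2 * G p.1 p.2 := by
    rw [← sum_antidiagonal_shift_left (fun i j => dunklNat κ i * dunklNat κ j * G i j)
        (by simp [dunklNat]),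
      ← sum_antidiagonal_shift_right
        (fun i j => dunklNat κ (i + 1) * dunklNat κ j * G (i + 1) j) (by simp [dunklNat]),
      binomialPart, Finset.mul_sum]
    refine Finset.sum_congr rfl fun p _ => ?_
    simp only [G, pow_succ]
    linear_combination (1 - ε * (-1) ^ p.1) / 2 * s * dunklMonomial κ s p.2 *
        mul_dunklMonomial hκ t p.1 + (1 - ε * (-1) ^ p.1) / 2 * dunklNat κ (p.1 + 1) *
        dunklMonomial κ t (p.1 + 1) * mul_dunklMonomial hκ s p.2
  calc _ = t ^ 2 * binomialPart κ t s ε (2 * m) + s ^ 2 * binomialPart κ t s ε (2 * m) +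
        2 * (s * t * binomialPart κ t s (-ε) (2 * m)) := by ring
    _ = _ := by
      rw [h1, h2, h3, binomialPart, Finset.mul_sum, Finset.mul_sum, ← Finset.sum_add_distrib,
        ← Finset.sum_add_distrib]
      refine Finset.sum_congr rfl fun p hp => ?_
      have hp' : p.1 + p.2 = 2 * m + 2 := Finset.HasAntidiagonal.mem_antidiagonal.mp hp
      have hpow : (-1 : ℝ) ^ p.2 = (-1) ^ p.1 := by
        have : (-1 : ℝ) ^ p.1 * (-1) ^ p.2 = 1 := by
          rw [← pow_add, hp']; simp [pow_add, pow_mul]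
        linear_combination (-1 : ℝ) ^ p.1 * this - (-1 : ℝ) ^ p.2 * neg_one_pow_mul_self p.1
      have hm : (m : ℝ) = ((p.1 : ℝ) + p.2) / 2 - 1 := by
        have : ((p.1 : ℝ) + p.2) = 2 * m + 2 := by exact_mod_cast hp'
        linarith
      simp only [hd, G, dunklNat, hpow, hm]
      obtain h | h := mul_self_eq_one_iff.mp hε <;>
        obtain h' | h' := neg_one_pow_eq_or ℝ p.1 <;> simp only [h, h'] <;> ring

end DunklFactorial

section WeightedIntegrals

variable {κ : ℝ}

lemma gegenbauerWeight_nonneg {u : ℝ} (hu : u ∈ Set.Ioo (-1 : ℝ) 1) :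
    0 ≤ gegenbauerWeight κ u :=
  Real.rpow_nonneg (by nlinarith [hu.1, hu.2]) _

lemma measurable_gegenbauerWeight : Measurable (gegenbauerWeight κ) := by
  unfold gegenbauerWeight; fun_prop

lemma integrableOn_gegenbauerWeight (hκ : 0 < κ) :
    IntegrableOn (gegenbauerWeight κ) (Set.Ioo (-1) 1) := by
  have hbase : IntervalIntegrable (fun u : ℝ => u ^ (κ - 1)) volume 0 1 :=
    intervalIntegral.intervalIntegrable_rpow' (by linarith)
  have h1 : IntervalIntegrable (fun u : ℝ => (1 - u) ^ (κ - 1) * (1 + u) ^ (κ - 1)) volume 0 1 := by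
    refine IntervalIntegrable.mul_continuousOn ?_ ?_
    · simpa using (hbase.comp_sub_left 1).symm
    · refine ContinuousOn.rpow_const (by fun_prop) fun u hu => Or.inl ?_
      rw [Set.uIcc_of_le zero_le_one] at hu
      linarith [hu.1]
  have h2 : IntervalIntegrable (fun u : ℝ => (1 - u) ^ (κ - 1) * (1 + u) ^ (κ - 1))
      volume (-1) 0 := by
    have := (h1.comp_sub_left 0).symm
    simp only [zero_sub, sub_zero, sub_neg_eq_add, ← sub_eq_add_neg] at this
    exact this.congr (fun u _ => mul_comm _ _)
  have h3 := (intervalIntegrable_iff_integrableOn_Ioo_of_le (by norm_num)).mp (h2.trans h1)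
  refine h3.congr_fun (fun u hu => ?_) measurableSet_Ioo
  simp only [gegenbauerWeight]
  rw [← Real.mul_rpow (by linarith [hu.2]) (by linarith [hu.1])]
  congr 1; ring

lemma integrableOn_mul_gegenbauerWeight (hκ : 0 < κ) {g : ℝ → ℝ} (hg : Continuous g) :
    IntegrableOn (fun u => g u * gegenbauerWeight κ u) (Set.Ioo (-1) 1) := by
  obtain ⟨C, hC⟩ := (isCompact_Icc (a := (-1 : ℝ)) (b := 1)).exists_bound_of_continuousOn
    hg.continuousOn
  refine (integrableOn_gegenbauerWeight hκ).bdd_mul (c := C) hg.aestronglyMeasurable ?_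
  exact (ae_restrict_iff' measurableSet_Ioo).mpr
    (.of_forall fun u hu => hC u (Set.Ioo_subset_Icc_self hu))

/-- Integration by parts against the Gegenbauer weight. -/
lemma integral_gegenbauerWeight_by_parts (hκ : 0 < κ) {g g' : ℝ → ℝ}
    (hg : ∀ u, HasDerivAt g (g' u) u) (hg' : Continuous g') :
    ∫ u in Set.Ioo (-1 : ℝ) 1, (g' u * (1 - u ^ 2) - 2 * κ * u * g u) * gegenbauerWeight κ u = 0 := by
  have hgc : Continuous g := continuous_iff_continuousAt.mpr fun u => (hg u).continuousAt
  have hint := integrableOn_mul_gegenbauerWeight hκ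
    (g := fun u => g' u * (1 - u ^ 2) - 2 * κ * u * g u) (by fun_prop)
  have key := intervalIntegral.integral_eq_sub_of_hasDerivAt_of_le (a := -1) (b := 1)
    (f := fun u => g u * (1 - u ^ 2) ^ κ)
    (f' := fun u => (g' u * (1 - u ^ 2) - 2 * κ * u * g u) * gegenbauerWeight κ u)
    (by norm_num)
    (hgc.continuousOn.mul (ContinuousOn.rpow_const (by fun_prop) fun _ _ => Or.inr hκ.le))
    (fun u hu => by
      have hpos : 0 < 1 - u ^ 2 := by nlinarith [hu.1, hu.2]
      have hd : HasDerivAt (fun u : ℝ => 1 - u ^ 2) (-(2 * u)) u := by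
        simpa using ((hasDerivAt_id u).pow 2).const_sub 1
      have := (hg u).mul (hd.rpow_const (p := κ) (Or.inl hpos.ne'))
      refine this.congr_deriv ?_
      rw [gegenbauerWeight]
      have : (1 - u ^ 2) ^ κ = (1 - u ^ 2) ^ (κ - 1) * (1 - u ^ 2) := by
        rw [← Real.rpow_add_one hpos.ne']; simp
      rw [this]; ring)
    ((intervalIntegrable_iff_integrableOn_Ioo_of_le (by norm_num)).mpr hint)
  rw [intervalIntegral.integral_of_le (by norm_num), integral_Ioc_eq_integral_Ioo] at key
  rw [key]
  simp [Real.zero_rpow hκ.ne']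

/-- The total mass of the Gegenbauer weight. -/
noncomputable def gegenbauerMass (κ : ℝ) : ℝ :=
  ∫ u in Set.Ioo (-1 : ℝ) 1, gegenbauerWeight κ u

lemma integral_pow_gegenbauerWeight_add_two (hκ : 0 < κ) (n : ℕ) :
    (n + 1 + 2 * κ) * ∫ u in Set.Ioo (-1 : ℝ) 1, u ^ (n + 2) * gegenbauerWeight κ u =
      (n + 1) * ∫ u in Set.Ioo (-1 : ℝ) 1, u ^ n * gegenbauerWeight κ u := by
  have h := integral_gegenbauerWeight_by_parts hκ (g := fun u => u ^ (n + 1))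
    (g' := fun u => (n + 1) * u ^ n) (fun u => by simpa using hasDerivAt_pow (n + 1) u)
    (by fun_prop)
  have hI := fun k : ℕ => integrableOn_mul_gegenbauerWeight hκ (continuous_pow k)
  rw [← integral_const_mul, ← integral_const_mul, ← sub_eq_zero,
    ← integral_sub ((hI _).const_mul _) ((hI _).const_mul _), ← neg_eq_zero, ← integral_neg, ← h]
  exact integral_congr_ae (.of_forall fun u => by ring)

lemma integral_odd_pow_gegenbauerWeight (hκ : 0 < κ) (m : ℕ) :
    ∫ u in Set.Ioo (-1 : ℝ) 1, u ^ (2 * m + 1) * gegenbauerWeight κ u = 0 := by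
  induction m with
  | zero =>
    have h := integral_gegenbauerWeight_by_parts hκ (g := fun _ => 1) (g' := fun _ => 0)
      (fun u => hasDerivAt_const _ _) (by fun_prop)
    have h' : -(2 * κ) * ∫ u in Set.Ioo (-1 : ℝ) 1, u ^ (2 * 0 + 1) * gegenbauerWeight κ u = 0 := by
      rw [← h, ← integral_const_mul]
      exact integral_congr_ae (.of_forall fun u => by ring)
    exact (mul_eq_zero.mp h').resolve_left (by simpa using hκ.ne')
  | succ m ih =>
    have h := integral_pow_gegenbauerWeight_add_two hκ (2 * m + 1)
    rw [ih, mul_zero] at h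
    exact (mul_eq_zero.mp h).resolve_left (by positivity)

/-- The moments of `(1 + u)(1 - u²)^{κ-1}`. -/
lemma integral_pow_mul_one_add (hκ : 0 < κ) (n : ℕ) :
    ∫ u in Set.Ioo (-1 : ℝ) 1, u ^ n * ((1 + u) * gegenbauerWeight κ u) =
      gegenbauerMass κ * n.factorial / dunklFactorial κ n := by
  have hI := fun k : ℕ => integrableOn_mul_gegenbauerWeight hκ (continuous_pow k)
  have hsplit : ∀ n : ℕ, ∫ u in Set.Ioo (-1 : ℝ) 1, u ^ n * ((1 + u) * gegenbauerWeight κ u) =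
      (∫ u in Set.Ioo (-1 : ℝ) 1, u ^ n * gegenbauerWeight κ u) +
        ∫ u in Set.Ioo (-1 : ℝ) 1, u ^ (n + 1) * gegenbauerWeight κ u := fun n => by
    rw [← integral_add (hI _) (hI _)]
    exact integral_congr_ae (.of_forall fun u => by ring)
  have hodd := integral_odd_pow_gegenbauerWeight hκ
  have hrec := integral_pow_gegenbauerWeight_add_two hκ
  induction n with
  | zero =>
    rw [hsplit, show 0 + 1 = 2 * 0 + 1 by rfl, hodd]
    simp [dunklFactorial, gegenbauerMass]
  | succ n ih =>
    have hγ := dunklFactorial_pos hκ n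
    have hd : 0 < dunklNat κ (n + 1) :=
      lt_of_lt_of_le (by positivity) (cast_le_dunklNat hκ (n + 1))
    have step : dunklNat κ (n + 1) *
        ∫ u in Set.Ioo (-1 : ℝ) 1, u ^ (n + 1) * ((1 + u) * gegenbauerWeight κ u) =
        (n + 1) * ∫ u in Set.Ioo (-1 : ℝ) 1, u ^ n * ((1 + u) * gegenbauerWeight κ u) := by
      rw [hsplit, hsplit]
      obtain ⟨m, hm | hm⟩ := Nat.even_or_odd' n
      · have := hrec n
        subst hm
        rw [hodd, dunklNat_two_mul_add_one]
        push_cast at this ⊢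
        linarith
      · have h2 := hodd (m + 1)
        subst hm
        rw [hodd, show 2 * m + 1 + 1 + 1 = 2 * (m + 1) + 1 by ring, h2,
          show 2 * m + 1 + 1 = 2 * (m + 1) by ring, dunklNat_two_mul]
        push_cast; ring
    rw [ih] at step
    rw [dunklFactorial, Nat.factorial_succ, eq_div_iff (by positivity)]
    rw [mul_div_assoc', eq_div_iff hγ.ne'] at step
    push_cast
    linear_combination step

/-- `t² + s² + 2stu` integrates, with its powers, to the Dunkl binomial sums. -/
lemma integral_pow_sq_add_sq (hκ : 0 < κ) (t s : ℝ) (m : ℕ) :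
    (∫ u in Set.Ioo (-1 : ℝ) 1, (t ^ 2 + s ^ 2 + 2 * s * t * u) ^ m * gegenbauerWeight κ u) =
        gegenbauerMass κ * (dunklFactorial κ (2 * m) * binomialPart κ t s 1 (2 * m)) ∧
      (∫ u in Set.Ioo (-1 : ℝ) 1,
          (u * (t ^ 2 + s ^ 2 + 2 * s * t * u) ^ m) * gegenbauerWeight κ u) =
        gegenbauerMass κ * (dunklFactorial κ (2 * m) * binomialPart κ t s (-1) (2 * m)) := by
  have hI : ∀ k l : ℕ, IntegrableOn (fun u => (u ^ l * (t ^ 2 + s ^ 2 + 2 * s * t * u) ^ k) *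
      gegenbauerWeight κ u) (Set.Ioo (-1) 1) := fun k l =>
    integrableOn_mul_gegenbauerWeight hκ (by fun_prop)
  have hI0 := fun k => by simpa using hI k 0
  have hI1 := fun k => by simpa using hI k 1
  induction m with
  | zero =>
    have := integral_odd_pow_gegenbauerWeight hκ 0
    simp only [mul_zero, zero_add, pow_one] at this
    simp [binomialPart, dunklFactorial, dunklMonomial, gegenbauerMass, this]
  | succ m ih =>
    obtain ⟨hP, hQ⟩ := ih
    have hfac : dunklFactorial κ (2 * (m + 1)) =
        2 * (m + 1) * ((2 * m + 1 + 2 * κ) * dunklFactorial κ (2 * m)) := by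
      rw [show 2 * (m + 1) = 2 * m + 1 + 1 by ring, dunklFactorial, dunklFactorial,
        show 2 * m + 1 + 1 = 2 * (m + 1) by ring, dunklNat_two_mul, dunklNat_two_mul_add_one]
      push_cast; ring
    have hE := sq_add_sq_mul_binomialPart hκ t s 1 (by norm_num) m
    have hO := sq_add_sq_mul_binomialPart hκ t s (-1) (by norm_num) m
    rw [neg_neg] at hO
    rw [show 2 * (m + 1) = 2 * m + 2 by ring] at hfac ⊢
    constructor
    · have : ∫ u in Set.Ioo (-1 : ℝ) 1,
          (t ^ 2 + s ^ 2 + 2 * s * t * u) ^ (m + 1) * gegenbauerWeight κ u =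
          (t ^ 2 + s ^ 2) * (∫ u in Set.Ioo (-1 : ℝ) 1,
            (t ^ 2 + s ^ 2 + 2 * s * t * u) ^ m * gegenbauerWeight κ u) +
          2 * s * t * ∫ u in Set.Ioo (-1 : ℝ) 1,
            (u * (t ^ 2 + s ^ 2 + 2 * s * t * u) ^ m) * gegenbauerWeight κ u := by
        rw [← integral_const_mul, ← integral_const_mul,
          ← integral_add ((hI0 m).const_mul _) ((hI1 m).const_mul _)]
        exact integral_congr_ae (.of_forall fun u => by ring)
      rw [this, hP, hQ, hfac]
      linear_combination gegenbauerMass κ * dunklFactorial κ (2 * m) * hE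
    · have h := integral_gegenbauerWeight_by_parts hκ
        (g := fun u => (t ^ 2 + s ^ 2 + 2 * s * t * u) ^ (m + 1))
        (g' := fun u => (m + 1) * (t ^ 2 + s ^ 2 + 2 * s * t * u) ^ m * (2 * s * t))
        (fun u => by
          have := (((hasDerivAt_id u).const_mul (2 * s * t)).const_add (t ^ 2 + s ^ 2)).pow (m + 1)
          simp only [Nat.cast_add, Nat.cast_one, add_tsub_cancel_right, id, mul_one] at this
          exact this) (by fun_prop)
      have : (m + 1 + 2 * κ) * (∫ u in Set.Ioo (-1 : ℝ) 1,
            (u * (t ^ 2 + s ^ 2 + 2 * s * t * u) ^ (m + 1)) * gegenbauerWeight κ u) =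
          ((m + 1) * (t ^ 2 + s ^ 2)) * (∫ u in Set.Ioo (-1 : ℝ) 1,
            (u * (t ^ 2 + s ^ 2 + 2 * s * t * u) ^ m) * gegenbauerWeight κ u) +
          ((m + 1) * (2 * s * t)) * ∫ u in Set.Ioo (-1 : ℝ) 1,
            (t ^ 2 + s ^ 2 + 2 * s * t * u) ^ m * gegenbauerWeight κ u := by
        rw [← integral_const_mul, ← integral_const_mul, ← integral_const_mul,
          ← integral_add ((hI1 m).const_mul _) ((hI0 m).const_mul _), ← sub_eq_zero,
          ← integral_sub ((hI1 (m + 1)).const_mul _)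
            (by exact ((hI1 m).const_mul _).add ((hI0 m).const_mul _)),
          ← neg_eq_zero, ← integral_neg, ← h]
        exact integral_congr_ae (.of_forall fun u => by ring)
      rw [hP, hQ] at this
      have hm : (0 : ℝ) < m + 1 + 2 * κ := by positivity
      refine mul_left_cancel₀ hm.ne' ?_
      rw [this, hfac]
      linear_combination (m + 1) * gegenbauerMass κ * dunklFactorial κ (2 * m) * hO

/-- The even or odd part in `(t, s)` of the translated monomial of degree `n`, at the angle
parameter `u`. -/
noncomputable def translatedMonomial (t s : ℝ) (n : ℕ) (u : ℝ) : ℝ :=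
  (t + s) ^ (n % 2) * (t ^ 2 + s ^ 2 + 2 * s * t * u) ^ (n / 2)

lemma integral_translatedMonomial (hκ : 0 < κ) (t s : ℝ) (n : ℕ) :
    ∫ u in Set.Ioo (-1 : ℝ) 1, translatedMonomial t s n u * ((1 + u) * gegenbauerWeight κ u) =
      gegenbauerMass κ * (dunklFactorial κ n *
        ∑ p ∈ antidiagonal n, dunklMonomial κ t p.1 * dunklMonomial κ s p.2) := by
  have key : ∀ m : ℕ, ∫ u in Set.Ioo (-1 : ℝ) 1,
      (t ^ 2 + s ^ 2 + 2 * s * t * u) ^ m * ((1 + u) * gegenbauerWeight κ u) =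
      gegenbauerMass κ * (dunklFactorial κ (2 * m) *
        ∑ p ∈ antidiagonal (2 * m), dunklMonomial κ t p.1 * dunklMonomial κ s p.2) := fun m => by
    obtain ⟨hP, hQ⟩ := integral_pow_sq_add_sq hκ t s m
    rw [← binomialPart_one_add, mul_add, mul_add, ← hP, ← hQ, ← integral_add]
    · exact integral_congr_ae (.of_forall fun u => by ring)
    · exact integrableOn_mul_gegenbauerWeight hκ (by fun_prop)
    · exact integrableOn_mul_gegenbauerWeight hκ (by fun_prop)
  obtain ⟨m, hm | hm⟩ := Nat.even_or_odd' n
  · simpa [translatedMonomial, hm] using key m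
  · have h1 : n % 2 = 1 := by omega
    have h2 : n / 2 = m := by omega
    simp only [translatedMonomial, h1, h2, pow_one, mul_assoc (t + s)]
    rw [integral_const_mul, key, hm, dunklFactorial]
    linear_combination gegenbauerMass κ * dunklFactorial κ (2 * m) *
      add_mul_sum_dunklMonomial hκ t s m

end WeightedIntegrals

section DunklKernel

variable {κ : ℝ}

lemma hasSum_integral_one_add_mul_gegenbauerWeight (hκ : 0 < κ) {c : ℕ → ℂ} {F : ℕ → ℝ → ℝ} {R : ℝ}
    {H : ℝ → ℂ} (hF : ∀ n, Continuous (F n)) (hb : ∀ n, ∀ u ∈ Set.Ioo (-1 : ℝ) 1, |F n u| ≤ R ^ n)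
    (hs : Summable fun n => ‖c n‖ * R ^ n)
    (hH : ∀ u ∈ Set.Ioo (-1 : ℝ) 1, HasSum (fun n => c n * (F n u : ℂ)) (H u)) :
    HasSum (fun n => c n *
        ((∫ u in Set.Ioo (-1 : ℝ) 1, F n u * ((1 + u) * gegenbauerWeight κ u) : ℝ) : ℂ))
      (∫ u in Set.Ioo (-1 : ℝ) 1, H u * (((1 + u) * gegenbauerWeight κ u : ℝ) : ℂ)) := by
  have hw : ∀ u ∈ Set.Ioo (-1 : ℝ) 1, 0 ≤ (1 + u) * gegenbauerWeight κ u := fun u hu =>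
    mul_nonneg (by linarith [hu.1]) (gegenbauerWeight_nonneg hu)
  have key := hasSum_integral_of_dominated_convergence
    (μ := volume.restrict (Set.Ioo (-1 : ℝ) 1))
    (F := fun n u => c n * (F n u : ℂ) * (((1 + u) * gegenbauerWeight κ u : ℝ) : ℂ))
    (f := fun u => H u * (((1 + u) * gegenbauerWeight κ u : ℝ) : ℂ))
    (fun n u => ‖c n‖ * R ^ n * ((1 + u) * gegenbauerWeight κ u))
    (fun n => by
      have h1 := (hF n).measurable
      have h2 := measurable_gegenbauerWeight (κ := κ)
      exact Measurable.aestronglyMeasurable (by fun_prop))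
    (fun n => (ae_restrict_iff' measurableSet_Ioo).mpr (.of_forall fun u hu => by
      rw [norm_mul, norm_mul, Complex.norm_real, Complex.norm_real, Real.norm_eq_abs,
        Real.norm_eq_abs, abs_of_nonneg (hw u hu)]
      have := hb n u hu
      have := hw u hu
      gcongr))
    (.of_forall fun u => hs.mul_right _)
    (by
      simp_rw [tsum_mul_right]
      exact (integrableOn_mul_gegenbauerWeight hκ (g := fun u => 1 + u) (by fun_prop)).const_mul _)
    ((ae_restrict_iff' measurableSet_Ioo).mpr (.of_forall fun u hu => (hH u hu).mul_right _))
  refine key.congr_fun fun n => ?_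
  rw [← integral_complex_ofReal, ← integral_const_mul]
  exact integral_congr_ae (.of_forall fun u => by push_cast; ring)

/-- `∫ Φ_κ`. -/
noncomputable def dunklMass (κ : ℝ) : ℝ := bk κ * gegenbauerMass κ

lemma summable_pow_div_dunklFactorial (hκ : 0 < κ) (x : ℝ) :
    Summable fun n => x ^ n / dunklFactorial κ n := by
  refine (Real.summable_pow_div_factorial |x|).of_norm_bounded fun n => ?_
  rw [norm_div, norm_pow, Real.norm_eq_abs, Real.norm_eq_abs,
    abs_of_pos (dunklFactorial_pos hκ n)]
  have := factorial_le_dunklFactorial hκ n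
  have : (0 : ℝ) < n.factorial := by exact_mod_cast n.factorial_pos
  gcongr

/-- The power series of the Dunkl kernel. -/
lemma hasSum_Ek (hκ : 0 < κ) (z w : ℂ) :
    HasSum (fun n => (dunklMass κ : ℂ) * ((z * w) ^ n / (dunklFactorial κ n : ℂ))) (Ek κ z w) := by
  have h := hasSum_integral_one_add_mul_gegenbauerWeight hκ
    (c := fun n => (z * w) ^ n / (n.factorial : ℂ)) (F := fun n u => u ^ n) (R := 1)
    (H := fun u => Complex.exp (z * w * u)) (fun n => by fun_prop)
    (fun n u hu => by
      rw [abs_pow]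
      exact pow_le_pow_left₀ (abs_nonneg u) (abs_le.mpr ⟨hu.1.le, hu.2.le⟩) n)
    (by simpa using Real.summable_pow_div_factorial ‖z * w‖)
    (fun u _ => by
      have := NormedSpace.expSeries_div_hasSum_exp (𝔸 := ℂ) (z * w * u)
      rw [← Complex.exp_eq_exp_ℂ] at this
      refine this.congr_fun fun n => ?_
      push_cast; rw [mul_pow]; ring)
  refine (h.mul_left (bk κ : ℂ)).congr_fun fun n => ?_
  rw [integral_pow_mul_one_add hκ, dunklMass]
  have h1 : (dunklFactorial κ n : ℂ) ≠ 0 := by exact_mod_cast (dunklFactorial_pos hκ n).ne'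
  have h2 : (n.factorial : ℂ) ≠ 0 := by exact_mod_cast n.factorial_ne_zero
  push_cast
  field_simp

lemma translatedMonomial_eq (t s : ℝ) (n : ℕ) {u : ℝ} (hu : u ∈ Set.Ioo (-1 : ℝ) 1) :
    √(t ^ 2 + s ^ 2 + 2 * s * t * u) ^ n * (1 + (t + s) / √(t ^ 2 + s ^ 2 + 2 * s * t * u)) +
      (-√(t ^ 2 + s ^ 2 + 2 * s * t * u)) ^ n *
        (1 - (t + s) / √(t ^ 2 + s ^ 2 + 2 * s * t * u)) = 2 * translatedMonomial t s n u := by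
  have hkey : t ^ 2 + s ^ 2 + 2 * s * t * u =
      ((1 + u) * (t + s) ^ 2 + (1 - u) * (t - s) ^ 2) / 2 := by ring
  have h1 : 0 < 1 + u := by linarith [hu.1]
  have h2 : 0 < 1 - u := by linarith [hu.2]
  have hnn : 0 ≤ t ^ 2 + s ^ 2 + 2 * s * t * u := by rw [hkey]; positivity
  have hsq := Real.sq_sqrt hnn
  have hq : √(t ^ 2 + s ^ 2 + 2 * s * t * u) * ((t + s) / √(t ^ 2 + s ^ 2 + 2 * s * t * u)) =
      t + s := by
    refine mul_div_cancel_of_imp' fun h0 => ?_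
    rw [h0, hkey] at hsq
    have : (1 + u) * (t + s) ^ 2 = 0 := by
      nlinarith [mul_nonneg h1.le (sq_nonneg (t + s)), mul_nonneg h2.le (sq_nonneg (t - s))]
    simpa [h1.ne'] using this
  generalize (t + s) / √(t ^ 2 + s ^ 2 + 2 * s * t * u) = q at *
  obtain ⟨m, hm | hm⟩ := Nat.even_or_odd' n
  · have e1 : n % 2 = 0 := by omega
    have e2 : n / 2 = m := by omega
    rw [translatedMonomial, e1, e2, hm, pow_mul, pow_mul, neg_sq, hsq]
    ring
  · have e1 : n % 2 = 1 := by omega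
    have e2 : n / 2 = m := by omega
    rw [translatedMonomial, e1, e2, hm, pow_succ _ (2 * m), pow_succ _ (2 * m), pow_mul, pow_mul,
      neg_sq, hsq]
    linear_combination 2 * (t ^ 2 + s ^ 2 + 2 * s * t * u) ^ m * hq

lemma abs_translatedMonomial_le (t s : ℝ) (n : ℕ) {u : ℝ} (hu : u ∈ Set.Ioo (-1 : ℝ) 1) :
    |translatedMonomial t s n u| ≤ (|t| + |s|) ^ n := by
  have h1 : |t + s| ≤ |t| + |s| := abs_add_le t s
  have h2 : |t ^ 2 + s ^ 2 + 2 * s * t * u| ≤ (|t| + |s|) ^ 2 := by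
    have hst : |2 * s * t * u| ≤ 2 * |t| * |s| := by
      rw [abs_mul, abs_mul, abs_mul, abs_two]
      nlinarith [abs_le.mpr ⟨hu.1.le, hu.2.le⟩, mul_nonneg (abs_nonneg s) (abs_nonneg t)]
    calc _ ≤ |t ^ 2 + s ^ 2| + |2 * s * t * u| := abs_add_le _ _
      _ ≤ (t ^ 2 + s ^ 2) + 2 * |t| * |s| := by
        rw [abs_of_nonneg (by positivity)]; gcongr
      _ = _ := by rw [← sq_abs t, ← sq_abs s]; ring
  rw [translatedMonomial, abs_mul, abs_pow, abs_pow]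
  calc _ ≤ (|t| + |s|) ^ (n % 2) * ((|t| + |s|) ^ 2) ^ (n / 2) := by gcongr
    _ = _ := by rw [← pow_mul, ← pow_add, Nat.mod_add_div]

/-- The product formula for the Dunkl kernel. -/
lemma tau_neg_Ek (hκ : 0 < κ) (s t : ℝ) (w : ℂ) :
    tau κ (-s) (fun x => Ek κ x w) t = Ek κ s w * Ek κ t w := by
  have hγ : ∀ n, (dunklFactorial κ n : ℂ) ≠ 0 := fun n => by
    exact_mod_cast (dunklFactorial_pos hκ n).ne'
  set R := |t| + |s|
  have hint := hasSum_integral_one_add_mul_gegenbauerWeight hκ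
    (c := fun n => 2 * (bk κ : ℂ) * ((dunklMass κ : ℂ) * (w ^ n / (dunklFactorial κ n : ℂ))))
    (F := translatedMonomial t s) (R := R)
    (H := fun u =>
      (Ek κ ((√(t ^ 2 + s ^ 2 + 2 * s * t * u) : ℝ) : ℂ) w *
          ((1 + (t + s) / √(t ^ 2 + s ^ 2 + 2 * s * t * u) : ℝ) : ℂ) +
        Ek κ ((-√(t ^ 2 + s ^ 2 + 2 * s * t * u) : ℝ) : ℂ) w *
          ((1 - (t + s) / √(t ^ 2 + s ^ 2 + 2 * s * t * u) : ℝ) : ℂ)) * (bk κ : ℂ))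
    (fun n => by unfold translatedMonomial; fun_prop)
    (fun n u hu => abs_translatedMonomial_le t s n hu)
    (by
      refine ((summable_pow_div_dunklFactorial hκ (‖w‖ * R)).mul_left
        (‖2 * (bk κ : ℂ)‖ * ‖(dunklMass κ : ℂ)‖)).congr fun n => ?_
      rw [norm_mul (2 * (bk κ : ℂ)), norm_mul (dunklMass κ : ℂ), norm_div, norm_pow,
        Complex.norm_real (dunklFactorial κ n), Real.norm_eq_abs (dunklFactorial κ n),
        abs_of_pos (dunklFactorial_pos hκ n)]
      ring_nf)
    (fun u hu => by
      have h1 := (hasSum_Ek hκ ((√(t ^ 2 + s ^ 2 + 2 * s * t * u) : ℝ) : ℂ) w).mul_right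
          ((1 + (t + s) / √(t ^ 2 + s ^ 2 + 2 * s * t * u) : ℝ) : ℂ)
      have h2 := (hasSum_Ek hκ ((-√(t ^ 2 + s ^ 2 + 2 * s * t * u) : ℝ) : ℂ) w).mul_right
          ((1 - (t + s) / √(t ^ 2 + s ^ 2 + 2 * s * t * u) : ℝ) : ℂ)
      refine ((h1.add h2).mul_right (bk κ : ℂ)).congr_fun fun n => ?_
      have h := congrArg (fun x : ℝ => (x : ℂ)) (translatedMonomial_eq t s n hu)
      push_cast at h ⊢
      rw [mul_pow, mul_pow]
      linear_combination (-(dunklMass κ : ℂ) * (w ^ n / (dunklFactorial κ n : ℂ)) * bk κ) * h)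
  have hprod : Ek κ s w * Ek κ t w = ∑' n, ∑ p ∈ antidiagonal n,
      ((dunklMass κ : ℂ) * (((t : ℂ) * w) ^ p.1 / (dunklFactorial κ p.1 : ℂ))) *
      ((dunklMass κ : ℂ) * (((s : ℂ) * w) ^ p.2 / (dunklFactorial κ p.2 : ℂ))) := by
    have hsum : ∀ x : ℝ, Summable fun n =>
        ‖(dunklMass κ : ℂ) * (((x : ℂ) * w) ^ n / (dunklFactorial κ n : ℂ))‖ := fun x => by
      refine ((summable_pow_div_dunklFactorial hκ ‖(x : ℂ) * w‖).mul_left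
        ‖(dunklMass κ : ℂ)‖).congr fun n => ?_
      rw [norm_mul (dunklMass κ : ℂ), norm_div, norm_pow,
        Complex.norm_real (dunklFactorial κ n), Real.norm_eq_abs (dunklFactorial κ n),
        abs_of_pos (dunklFactorial_pos hκ n)]
    rw [← tsum_mul_tsum_eq_tsum_sum_antidiagonal_of_summable_norm (hsum t) (hsum s),
      (hasSum_Ek hκ t w).tsum_eq, (hasSum_Ek hκ s w).tsum_eq, mul_comm]
  have htau : tau κ (-s) (fun x => Ek κ x w) t = (1 / 2 : ℂ) * ∫ u in Set.Ioo (-1 : ℝ) 1,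
      ((Ek κ ((√(t ^ 2 + s ^ 2 + 2 * s * t * u) : ℝ) : ℂ) w *
          ((1 + (t + s) / √(t ^ 2 + s ^ 2 + 2 * s * t * u) : ℝ) : ℂ) +
        Ek κ ((-√(t ^ 2 + s ^ 2 + 2 * s * t * u) : ℝ) : ℂ) w *
          ((1 - (t + s) / √(t ^ 2 + s ^ 2 + 2 * s * t * u) : ℝ) : ℂ)) * (bk κ : ℂ)) *
        (((1 + u) * gegenbauerWeight κ u : ℝ) : ℂ) := by
    unfold tau
    congr 1
    refine integral_congr_ae (.of_forall fun u => ?_)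
    have e1 : t ^ 2 + (-s) ^ 2 - 2 * -s * t * u = t ^ 2 + s ^ 2 + 2 * s * t * u := by ring
    have e2 : Phi κ u = bk κ * ((1 + u) * gegenbauerWeight κ u) := by
      rw [Phi, gegenbauerWeight]; ring
    simp only [e1, e2, sub_neg_eq_add, Complex.ofReal_mul (bk κ)]
    ring
  rw [htau, ← hint.tsum_eq, hprod, ← tsum_mul_left]
  refine tsum_congr fun n => ?_
  rw [integral_translatedMonomial hκ]
  push_cast [dunklMonomial]
  simp only [Finset.mul_sum]
  refine Finset.sum_congr rfl fun p hp => ?_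
  have hp' : p.1 + p.2 = n := Finset.HasAntidiagonal.mem_antidiagonal.mp hp
  have := hγ n
  have := hγ p.1
  have := hγ p.2
  rw [mul_pow, mul_pow, show w ^ n = w ^ p.1 * w ^ p.2 by rw [← pow_add, hp']]
  have hB : (dunklMass κ : ℂ) = bk κ * gegenbauerMass κ := by rw [dunklMass]; push_cast; rfl
  rw [hB]
  field_simp

end DunklKernel

section TranslationKernel

variable {κ : ℝ}

/-- The cosine parameter `u` determined by `z² = t² + s² - 2stu`. -/
noncomputable def cosParam (s t z : ℝ) : ℝ := (t ^ 2 + s ^ 2 - z ^ 2) / (2 * s * t)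

open Classical in
/-- The Lebesgue density of the measure `f ↦ |t|^{2κ} τ_s f(t)`. -/
noncomputable def translationKernel (κ s t z : ℝ) : ℝ :=
  if cosParam s t z ^ 2 < 1 then
    |z| / |s * t| * (|t| ^ (2 * κ) / 2 * ((1 + (t - s) / z) * Phi κ (cosParam s t z)))
  else 0

lemma measurable_cosParam (s : ℝ) : Measurable fun p : ℝ × ℝ => cosParam s p.1 p.2 := by
  unfold cosParam; fun_prop

lemma measurable_Phi : Measurable (Phi κ) := by
  unfold Phi; fun_prop

lemma measurable_translationKernel (s : ℝ) :
    Measurable fun p : ℝ × ℝ => translationKernel κ s p.1 p.2 := by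
  have h1 := measurable_cosParam s
  have h2 := (measurable_Phi (κ := κ)).comp h1
  refine Measurable.ite (measurableSet_lt (h1.pow_const 2) measurable_const) ?_ measurable_const
  simp only [Function.comp_def] at h2
  fun_prop

lemma translationKernel_symm {s t z : ℝ} (hs : s ≠ 0) (ht : t ≠ 0) (hz : z ≠ 0) :
    translationKernel κ s t z = translationKernel κ (-s) z t := by
  have hsymm : t ^ 2 * (1 - cosParam s t z ^ 2) = z ^ 2 * (1 - cosParam (-s) z t ^ 2) := by
    unfold cosParam; field_simp; ring
  have ht2 : 0 < t ^ 2 := by positivity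
  have hz2 : 0 < z ^ 2 := by positivity
  have hiff : cosParam s t z ^ 2 < 1 ↔ cosParam (-s) z t ^ 2 < 1 := by
    rw [← sub_pos, ← sub_pos (b := cosParam (-s) z t ^ 2), ← mul_pos_iff_of_pos_left ht2, hsymm,
      mul_pos_iff_of_pos_left hz2]
  unfold translationKernel
  by_cases h : cosParam s t z ^ 2 < 1
  swap
  · rw [if_neg h, if_neg (hiff.not.mp h)]
  rw [if_pos h, if_pos (hiff.mp h)]
  have hpow : ∀ x a : ℝ, x ≠ 0 → a ^ 2 < 1 →
      |x| ^ (2 * κ) * (1 - a ^ 2) ^ (κ - 1) = x ^ 2 * (x ^ 2 * (1 - a ^ 2)) ^ (κ - 1) := by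
    intro x a hx ha
    have hx2 : 0 < x ^ 2 := by positivity
    rw [Real.mul_rpow hx2.le (by linarith), Real.rpow_mul (abs_nonneg x), Real.rpow_two, sq_abs,
      ← mul_assoc]
    congr 1
    rw [Real.rpow_sub_one hx2.ne']
    field_simp
  have h1 := hpow t _ ht h
  have h2 := hpow z _ hz (hiff.mp h)
  rw [← hsymm] at h2
  have halg : |z| / |s * t| * ((1 + (t - s) / z) * (1 + cosParam s t z)) * t ^ 2 =
      |t| / |-s * z| * ((1 + (z - -s) / t) * (1 + cosParam (-s) z t)) * z ^ 2 := by
    have e : (1 + (t - s) / z) * (1 + cosParam s t z) =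
        (1 + (z - -s) / t) * (1 + cosParam (-s) z t) := by
      unfold cosParam; field_simp; ring
    rw [e, ← sq_abs t, ← sq_abs z, abs_mul, abs_mul, abs_neg]
    have := abs_pos.mpr hs
    have := abs_pos.mpr ht
    have := abs_pos.mpr hz
    field_simp
  unfold Phi
  linear_combination
    (|z| / |s * t| / 2 * (1 + (t - s) / z) * (bk κ * (1 + cosParam s t z))) * h1 -
    (|t| / |-s * z| / 2 * (1 + (z - -s) / t) * (bk κ * (1 + cosParam (-s) z t))) * h2 +
    bk κ / 2 * (t ^ 2 * (1 - cosParam s t z ^ 2)) ^ (κ - 1) * halg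

section ChangeOfVariables

variable {s t : ℝ} {E : Type*} [NormedAddCommGroup E] [NormedSpace ℝ E]

lemma sqrt_cosParam (hs : s ≠ 0) (ht : t ≠ 0) {z : ℝ} (hz : 0 < z) :
    √(t ^ 2 + s ^ 2 - 2 * s * t * cosParam s t z) = z := by
  rw [show t ^ 2 + s ^ 2 - 2 * s * t * cosParam s t z = z ^ 2 by unfold cosParam; field_simp; ring,
    Real.sqrt_sq hz.le]

lemma sq_add_sq_sub_pos (hs : s ≠ 0) {u : ℝ} (hu : u ∈ Set.Ioo (-1 : ℝ) 1) :
    0 < t ^ 2 + s ^ 2 - 2 * s * t * u := by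
  have h1 : 0 < 1 - u ^ 2 := by nlinarith [hu.1, hu.2]
  have h2 : 0 < s ^ 2 := by positivity
  nlinarith [sq_nonneg (t - s * u), mul_pos h1 h2]

lemma image_cosParam (hs : s ≠ 0) (ht : t ≠ 0) :
    cosParam s t '' (Set.Ioi 0 ∩ {z | cosParam s t z ^ 2 < 1}) = Set.Ioo (-1) 1 := by
  ext u
  constructor
  · rintro ⟨z, ⟨-, hz⟩, rfl⟩
    exact abs_lt.mp ((sq_lt_one_iff_abs_lt_one _).mp hz)
  · intro hu
    have hpos := sq_add_sq_sub_pos (t := t) hs hu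
    have e : cosParam s t √(t ^ 2 + s ^ 2 - 2 * s * t * u) = u := by
      rw [cosParam, Real.sq_sqrt hpos.le]; field_simp; ring
    refine ⟨_, ⟨Real.sqrt_pos.mpr hpos, ?_⟩, e⟩
    simp only [Set.mem_ofPred_eq, e]
    nlinarith [hu.1, hu.2]

lemma measurableSet_cosParam (s t : ℝ) :
    MeasurableSet {z | cosParam s t z ^ 2 < 1} :=
  measurableSet_lt (((measurable_cosParam s).comp measurable_prodMk_left).pow_const 2)
    measurable_const

lemma hasDerivAt_cosParam (s t z : ℝ) :
    HasDerivAt (cosParam s t) (-(2 * z) / (2 * s * t)) z := by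
  refine (((hasDerivAt_pow 2 z).const_sub (t ^ 2 + s ^ 2)).div_const (2 * s * t)).congr_deriv ?_
  simp

lemma injOn_cosParam (hs : s ≠ 0) (ht : t ≠ 0) :
    Set.InjOn (cosParam s t) (Set.Ioi 0 ∩ {z | cosParam s t z ^ 2 < 1}) := by
  intro a ha b hb hab
  rw [← sqrt_cosParam hs ht ha.1, ← sqrt_cosParam hs ht hb.1, hab]

lemma abs_deriv_cosParam (z : ℝ) : |-(2 * z) / (2 * s * t)| = |z| / |s * t| := by
  rw [mul_assoc, neg_div, abs_neg, mul_div_mul_left _ _ two_ne_zero, abs_div]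

open Classical in
lemma integral_comp_sqrt (hs : s ≠ 0) (ht : t ≠ 0) (G : ℝ → ℝ → E) :
    ∫ u in Set.Ioo (-1 : ℝ) 1, G √(t ^ 2 + s ^ 2 - 2 * s * t * u) u =
      ∫ z in Set.Ioi 0, if cosParam s t z ^ 2 < 1 then
        (|z| / |s * t|) • G z (cosParam s t z) else 0 := by
  have h := integral_image_eq_integral_abs_deriv_smul
    (measurableSet_Ioi.inter (measurableSet_cosParam s t))
    (fun z _ => (hasDerivAt_cosParam s t z).hasDerivWithinAt) (injOn_cosParam hs ht)
    (fun u => G √(t ^ 2 + s ^ 2 - 2 * s * t * u) u)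
  rw [image_cosParam hs ht] at h
  rw [h, ← setIntegral_indicator (measurableSet_cosParam s t)]
  refine setIntegral_congr_fun measurableSet_Ioi fun z hz => ?_
  simp only [Set.indicator_apply, Set.mem_ofPred_eq, sqrt_cosParam hs ht hz, abs_deriv_cosParam]

open Classical in
lemma integrableOn_comp_sqrt (hs : s ≠ 0) (ht : t ≠ 0) {G : ℝ → ℝ → E}
    (hG : IntegrableOn (fun u => G √(t ^ 2 + s ^ 2 - 2 * s * t * u) u) (Set.Ioo (-1) 1)) :
    IntegrableOn (fun z => if cosParam s t z ^ 2 < 1 then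
        (|z| / |s * t|) • G z (cosParam s t z) else 0) (Set.Ioi 0) := by
  have h := integrableOn_image_iff_integrableOn_abs_deriv_smul
    (measurableSet_Ioi.inter (measurableSet_cosParam s t))
    (fun z _ => (hasDerivAt_cosParam s t z).hasDerivWithinAt) (injOn_cosParam hs ht)
    (fun u => G √(t ^ 2 + s ^ 2 - 2 * s * t * u) u)
  rw [image_cosParam hs ht] at h
  have h' := h.mp hG
  rw [Set.inter_comm, ← integrableOn_indicator_iff (measurableSet_cosParam s t)] at h'
  refine IntegrableOn.congr_fun h' (fun z hz => ?_) measurableSet_Ioi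
  simp only [Set.indicator_apply, Set.mem_ofPred_eq, sqrt_cosParam hs ht hz, abs_deriv_cosParam]

end ChangeOfVariables

lemma cosParam_neg (s t z : ℝ) : cosParam s t (-z) = cosParam s t z := by
  simp [cosParam]

lemma abs_one_add_mul_Phi_le {s t ε u : ℝ} (hs : s ≠ 0) (hε : |ε| = 1)
    (hu : u ∈ Set.Ioo (-1 : ℝ) 1) :
    |(1 + ε * ((t - s) / √(t ^ 2 + s ^ 2 - 2 * s * t * u))) * Phi κ u| ≤
      4 * |bk κ| * gegenbauerWeight κ u := by
  have hpos := sq_add_sq_sub_pos (t := t) hs hu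
  set r := √(t ^ 2 + s ^ 2 - 2 * s * t * u) with hr
  have hr0 : 0 < r := Real.sqrt_pos.mpr hpos
  have hr2 : r ^ 2 = t ^ 2 + s ^ 2 - 2 * s * t * u := Real.sq_sqrt hpos.le
  have h1 : 0 < 1 + u := by linarith [hu.1]
  have h2 : 0 < 1 - u := by linarith [hu.2]
  have hq : |(t - s) / r| * (1 + u) ≤ 2 := by
    rw [abs_div, abs_of_pos hr0, div_mul_eq_mul_div, div_le_iff₀ hr0]
    refine abs_le_of_sq_le_sq' (?_ : (|t - s| * (1 + u)) ^ 2 ≤ (2 * r) ^ 2) (by positivity) |>.2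
    rw [mul_pow, sq_abs, mul_pow, hr2]
    nlinarith [mul_nonneg (mul_nonneg h1.le h2.le) (sq_nonneg (t + s)),
      mul_nonneg h2.le (sq_nonneg (t + s)),
      mul_nonneg (mul_nonneg h1.le h2.le) (sq_nonneg (t - s)), sq_nonneg (t - s)]
  have hw := gegenbauerWeight_nonneg (κ := κ) hu
  have hb : |1 + ε * ((t - s) / r)| * (1 + u) ≤ 4 := by
    have : |1 + ε * ((t - s) / r)| ≤ 1 + |(t - s) / r| := by
      refine (abs_add_le _ _).trans ?_
      rw [abs_one, abs_mul, hε, one_mul]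
    nlinarith [hu.2]
  have e : |(1 + ε * ((t - s) / r)) * Phi κ u| =
      |1 + ε * ((t - s) / r)| * (1 + u) * (|bk κ| * gegenbauerWeight κ u) := by
    rw [Phi, ← gegenbauerWeight, abs_mul, abs_mul, abs_mul, abs_of_pos h1, abs_of_nonneg hw]; ring
  rw [e, mul_assoc 4]
  gcongr

lemma integrableOn_one_add_mul_Phi (hκ : 0 < κ) {s ε : ℝ} (t : ℝ) (hs : s ≠ 0) (hε : |ε| = 1) :
    IntegrableOn (fun u => (1 + ε * ((t - s) / √(t ^ 2 + s ^ 2 - 2 * s * t * u))) * Phi κ u)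
      (Set.Ioo (-1) 1) := by
  refine ((integrableOn_gegenbauerWeight hκ).const_mul (4 * |bk κ|)).mono' ?_ ?_
  · have := measurable_Phi (κ := κ)
    exact Measurable.aestronglyMeasurable (by fun_prop)
  · exact (ae_restrict_iff' measurableSet_Ioo).mpr
      (.of_forall fun u hu => abs_one_add_mul_Phi_le hs hε hu)

/-- A bound for the total variation of the translation kernel on a half-line. -/
lemma integrableOn_translationKernel (hκ : 0 < κ) {s t ε : ℝ} (hs : s ≠ 0) (ht : t ≠ 0)
    (hε : ε = 1 ∨ ε = -1) :
    IntegrableOn (fun z => translationKernel κ s t (ε * z)) (Set.Ioi 0) ∧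
      ∫ z in Set.Ioi 0, |translationKernel κ s t (ε * z)| ≤
        2 * |bk κ| * gegenbauerMass κ * |t| ^ (2 * κ) := by
  have hε' : |ε| = 1 := by rcases hε with h | h <;> simp [h]
  have hK : ∀ z, translationKernel κ s t (ε * z) = if cosParam s t z ^ 2 < 1 then
      (|z| / |s * t|) • (|t| ^ (2 * κ) / 2 *
        ((1 + ε * ((t - s) / z)) * Phi κ (cosParam s t z))) else 0 := fun z => by
    unfold translationKernel
    rcases hε with h | h <;> simp [h, cosParam_neg, div_neg]
  have hint := (integrableOn_one_add_mul_Phi hκ t hs hε').const_mul (|t| ^ (2 * κ) / 2)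
  refine ⟨?_, ?_⟩
  · simp only [hK]
    exact integrableOn_comp_sqrt hs ht
      (G := fun z u => |t| ^ (2 * κ) / 2 * ((1 + ε * ((t - s) / z)) * Phi κ u)) hint
  · have h := integral_comp_sqrt hs ht
      (fun z u => |(|t| ^ (2 * κ) / 2 * ((1 + ε * ((t - s) / z)) * Phi κ u))|)
    have e : ∀ z, |translationKernel κ s t (ε * z)| = if cosParam s t z ^ 2 < 1 then
        (|z| / |s * t|) • |(|t| ^ (2 * κ) / 2 *
          ((1 + ε * ((t - s) / z)) * Phi κ (cosParam s t z)))| else 0 := fun z => by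
      rw [hK]
      split_ifs
      · rw [smul_eq_mul, smul_eq_mul, abs_mul, abs_of_nonneg (by positivity : 0 ≤ |z| / |s * t|)]
      · simp
    simp only [e]
    rw [← h]
    have ht0 : 0 ≤ |t| ^ (2 * κ) := by positivity
    calc _ ≤ ∫ u in Set.Ioo (-1 : ℝ) 1,
          |t| ^ (2 * κ) / 2 * (4 * |bk κ| * gegenbauerWeight κ u) := by
          refine setIntegral_mono_on hint.abs
            (((integrableOn_gegenbauerWeight hκ).const_mul _).const_mul _) measurableSet_Ioo
            fun u hu => ?_
          rw [abs_mul, abs_of_nonneg (by positivity : 0 ≤ |t| ^ (2 * κ) / 2)]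
          exact mul_le_mul_of_nonneg_left (abs_one_add_mul_Phi_le hs hε' hu) (by positivity)
      _ = _ := by
          rw [integral_const_mul, integral_const_mul, gegenbauerMass]; ring

lemma integrable_of_integrableOn_Ioi {E : Type*} [NormedAddCommGroup E] {h : ℝ → E}
    (h1 : IntegrableOn h (Set.Ioi 0)) (h2 : IntegrableOn (fun z => h (-z)) (Set.Ioi 0)) :
    Integrable h := by
  have h3 : IntegrableOn h (Set.Iio 0) := by
    have := (Measure.measurePreserving_neg (volume : Measure ℝ)).integrableOn_comp_preimage
      (Homeomorph.neg ℝ).measurableEmbedding (f := h) (s := Set.Iio 0)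
    rw [← this]
    simpa [Function.comp_def] using h2
  rw [← integrableOn_univ, ← Set.Iic_union_Ioi (a := (0 : ℝ))]
  exact (Iff.mpr integrableOn_Iic_iff_integrableOn_Iio h3).union h1

lemma integral_eq_integral_Ioi_add_neg {E : Type*} [NormedAddCommGroup E] [NormedSpace ℝ E]
    {h : ℝ → E} (hh : Integrable h) : ∫ z, h z = ∫ z in Set.Ioi 0, (h z + h (-z)) := by
  rw [integral_add hh.integrableOn hh.comp_neg.integrableOn, integral_comp_neg_Ioi, neg_zero,
    add_comm, intervalIntegral.integral_Iic_add_Ioi hh.integrableOn hh.integrableOn]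

lemma integrable_translationKernel (hκ : 0 < κ) {s t : ℝ} (hs : s ≠ 0) (ht : t ≠ 0) :
    Integrable (translationKernel κ s t) := by
  have h1 := (integrableOn_translationKernel hκ hs ht (Or.inl rfl)).1
  have h2 := (integrableOn_translationKernel hκ hs ht (Or.inr rfl)).1
  simp only [one_mul, neg_mul] at h1 h2
  exact integrable_of_integrableOn_Ioi h1 h2

lemma integral_abs_translationKernel_le (hκ : 0 < κ) {s t : ℝ} (hs : s ≠ 0) (ht : t ≠ 0) :
    ∫ z, |translationKernel κ s t z| ≤ 4 * |bk κ| * gegenbauerMass κ * |t| ^ (2 * κ) := by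
  have h := (integrable_translationKernel hκ hs ht).abs
  obtain ⟨h1, h1'⟩ := integrableOn_translationKernel hκ hs ht (Or.inl rfl)
  obtain ⟨h2, h2'⟩ := integrableOn_translationKernel hκ hs ht (Or.inr rfl)
  simp only [one_mul, neg_mul] at h1 h2 h1' h2'
  rw [integral_eq_integral_Ioi_add_neg h, integral_add h1.abs h2.abs]
  linarith

/-- The generalized translation as an integral operator. -/
lemma tau_mul_eq_integral {s t : ℝ} (hs : s ≠ 0) (ht : t ≠ 0) {f : ℝ → ℂ}
    (hf : Integrable fun z => f z * (translationKernel κ s t z : ℂ)) :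
    tau κ s f t * ((|t| ^ (2 * κ) : ℝ) : ℂ) = ∫ z, f z * (translationKernel κ s t z : ℂ) := by
  have h := integral_comp_sqrt hs ht (fun z u => (f z * ((1 + (t - s) / z : ℝ) : ℂ) +
      f (-z) * ((1 - (t - s) / z : ℝ) : ℂ)) * ((Phi κ u : ℝ) : ℂ))
  rw [tau, h, integral_eq_integral_Ioi_add_neg hf, mul_comm, ← mul_assoc, ← integral_const_mul]
  refine integral_congr_ae (.of_forall fun z => ?_)
  simp only [translationKernel, cosParam_neg]
  split_ifs
  · rw [Complex.real_smul, div_neg, abs_neg]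
    push_cast
    ring
  · simp

end TranslationKernel

section Duality

variable {κ : ℝ}

lemma integral_mu (h : ℝ → ℂ) : ∫ t, h t ∂(mu κ) = ∫ t, h t * ((|t| ^ (2 * κ) : ℝ) : ℂ) := by
  rw [mu, integral_withDensity_eq_integral_toReal_smul (by fun_prop)
    (.of_forall fun t => ENNReal.ofReal_lt_top)]
  refine integral_congr_ae (.of_forall fun t => ?_)
  simp only
  rw [ENNReal.toReal_ofReal (by positivity), Complex.real_smul, mul_comm]

lemma integrable_mu_iff {h : ℝ → ℂ} :
    Integrable h (mu κ) ↔ Integrable fun t => h t * ((|t| ^ (2 * κ) : ℝ) : ℂ) := by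
  rw [mu, integrable_withDensity_iff_integrable_smul' (by fun_prop)
    (.of_forall fun t => ENNReal.ofReal_lt_top)]
  refine integrable_congr (.of_forall fun t => ?_)
  simp only
  rw [ENNReal.toReal_ofReal (by positivity), Complex.real_smul, mul_comm]

lemma ae_ne_zero : ∀ᵐ t : ℝ, t ≠ 0 := Measure.ae_ne volume 0

lemma aestronglyMeasurable_of_integrable_mu {f : ℝ → ℂ} (hf : Integrable f (mu κ)) :
    AEStronglyMeasurable f := by
  have h := (integrable_mu_iff.mp hf).aestronglyMeasurable
  have hm : AEStronglyMeasurable (fun t : ℝ => (((|t| ^ (2 * κ))⁻¹ : ℝ) : ℂ)) volume :=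
    Measurable.aestronglyMeasurable (by fun_prop)
  refine (h.mul hm).congr ?_
  filter_upwards [ae_ne_zero] with t ht
  have : (|t| ^ (2 * κ) : ℝ) ≠ 0 := (Real.rpow_pos_of_pos (abs_pos.mpr ht) _).ne'
  simp only [Pi.mul_apply]
  rw [mul_assoc, ← Complex.ofReal_mul, mul_inv_cancel₀ this, Complex.ofReal_one, mul_one]

lemma integrable_mul_translationKernel (hκ : 0 < κ) {s : ℝ} (hs : s ≠ 0) {f : ℝ → ℂ}
    (hf : Integrable f (mu κ)) :
    Integrable (fun p : ℝ × ℝ => f p.2 * (translationKernel κ s p.1 p.2 : ℂ))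
      (volume.prod volume) := by
  have hmeas : AEStronglyMeasurable
      (fun p : ℝ × ℝ => f p.2 * (translationKernel κ s p.1 p.2 : ℂ)) (volume.prod volume) :=
    (aestronglyMeasurable_of_integrable_mu hf).comp_snd.mul
      (Complex.measurable_ofReal.comp (measurable_translationKernel s)).aestronglyMeasurable
  have hsymm : ∀ z : ℝ, z ≠ 0 → ∀ᵐ t : ℝ,
      translationKernel κ (-s) z t = translationKernel κ s t z := fun z hz => by
    filter_upwards [ae_ne_zero] with t ht
    exact (translationKernel_symm hs ht hz).symm
  refine (integrable_prod_iff' hmeas).mpr ⟨?_, ?_⟩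
  · filter_upwards [ae_ne_zero] with z hz
    refine Integrable.const_mul ?_ _
    exact ((integrable_translationKernel hκ (neg_ne_zero.mpr hs) hz).congr (hsymm z hz)).ofReal
  · refine ((integrable_mu_iff.mp hf).norm.const_mul (4 * |bk κ| * gegenbauerMass κ)).mono'
      hmeas.prod_swap.norm.integral_prod_right' ?_
    filter_upwards [ae_ne_zero] with z hz
    rw [Real.norm_of_nonneg (integral_nonneg fun t => norm_nonneg _)]
    simp only [norm_mul, Complex.norm_real, Real.norm_eq_abs]
    rw [integral_const_mul, abs_of_nonneg (by positivity : 0 ≤ |z| ^ (2 * κ))]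
    have h := integral_abs_translationKernel_le hκ (neg_ne_zero.mpr hs) hz
    rw [integral_congr_ae ((hsymm z hz).mono fun t ht => congrArg abs ht)] at h
    calc _ ≤ ‖f z‖ * (4 * |bk κ| * gegenbauerMass κ * |z| ^ (2 * κ)) :=
          mul_le_mul_of_nonneg_left h (norm_nonneg _)
      _ = _ := by ring

/-- The adjoint of `τ_s` with respect to `μ_κ` is `τ_{-s}`. -/
lemma integral_tau_mul (hκ : 0 < κ) {s : ℝ} (hs : s ≠ 0) {f g : ℝ → ℂ}
    (hf : Integrable f (mu κ)) (hg : StronglyMeasurable g) {C : ℝ} (hC : ∀ t, ‖g t‖ ≤ C) :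
    ∫ t, tau κ s f t * g t ∂(mu κ) = ∫ z, f z * tau κ (-s) g z ∂(mu κ) := by
  have hH := integrable_mul_translationKernel hκ hs hf
  have hHg : Integrable (Function.uncurry fun t z : ℝ =>
      g t * (f z * (translationKernel κ s t z : ℂ))) (volume.prod volume) :=
    hH.bdd_mul (c := C) (f := fun p : ℝ × ℝ => g p.1)
      (hg.comp_measurable measurable_fst).aestronglyMeasurable (.of_forall fun p => hC p.1)
  rw [integral_mu, integral_mu]
  calc _ = ∫ t, ∫ z, g t * (f z * (translationKernel κ s t z : ℂ)) := by
        refine integral_congr_ae ?_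
        filter_upwards [ae_ne_zero, hH.prod_right_ae] with t ht hi
        rw [integral_const_mul, ← tau_mul_eq_integral hs ht hi]
        ring
    _ = ∫ z, ∫ t, g t * (f z * (translationKernel κ s t z : ℂ)) := integral_integral_swap hHg
    _ = _ := by
        refine integral_congr_ae ?_
        filter_upwards [ae_ne_zero] with z hz
        have hs' := neg_ne_zero.mpr hs
        have hi : Integrable fun t => g t * (translationKernel κ (-s) z t : ℂ) :=
          (integrable_translationKernel hκ hs' hz).ofReal.bdd_mul (c := C)
            hg.aestronglyMeasurable (.of_forall hC)
        rw [mul_assoc, tau_mul_eq_integral hs' hz hi, ← integral_const_mul]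
        refine integral_congr_ae ?_
        filter_upwards [ae_ne_zero] with t ht
        rw [translationKernel_symm hs ht hz]
        ring

lemma stronglyMeasurable_Ek (w : ℂ) : StronglyMeasurable fun x : ℝ => Ek κ x w := by
  refine StronglyMeasurable.const_mul ?_ _
  refine StronglyMeasurable.integral_prod_right' (f := fun p : ℝ × ℝ =>
    Complex.exp (p.1 * w * (p.2 : ℂ)) * (((1 + p.2) * (1 - p.2 ^ 2) ^ (κ - 1) : ℝ) : ℂ)) ?_
  exact Measurable.stronglyMeasurable (by fun_prop)

lemma norm_Ek_le (x y : ℝ) : ‖Ek κ x (-Complex.I * y)‖ ≤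
    |bk κ| * ∫ u in Set.Ioo (-1 : ℝ) 1, ‖(1 + u) * (1 - u ^ 2) ^ (κ - 1)‖ := by
  rw [Ek, norm_mul, Complex.norm_real, Real.norm_eq_abs]
  refine mul_le_mul_of_nonneg_left ((norm_integral_le_integral_norm _).trans_eq ?_) (abs_nonneg _)
  refine integral_congr_ae (.of_forall fun u => ?_)
  simp only
  rw [norm_mul, Complex.norm_real, show (x : ℂ) * (-Complex.I * y) * u =
    ((-(x * y * u) : ℝ) : ℂ) * Complex.I by push_cast; ring, Complex.norm_exp_ofReal_mul_I, one_mul]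

lemma Ek_zero_left (w : ℂ) : Ek κ 0 w = ∫ u in Set.Ioo (-1 : ℝ) 1, ((Phi κ u : ℝ) : ℂ) := by
  rw [Ek, ← integral_const_mul]
  refine integral_congr_ae (.of_forall fun u => ?_)
  simp only [Phi, zero_mul, Complex.exp_zero, one_mul]
  push_cast
  ring

lemma tau_zero {t : ℝ} (ht : t ≠ 0) (f : ℝ → ℂ) (w : ℂ) : tau κ 0 f t = Ek κ 0 w * f t := by
  rw [Ek_zero_left, tau, mul_comm _ (f t), ← integral_const_mul, ← integral_const_mul]
  refine integral_congr_ae (.of_forall fun u => ?_)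
  have e : √(t ^ 2 + 0 ^ 2 - 2 * 0 * t * u) = |t| := by
    rw [← Real.sqrt_sq_eq_abs]; ring_nf
  simp only [e, sub_zero]
  rcases ht.lt_or_gt with h | h
  · rw [abs_of_neg h, neg_neg, div_neg, div_self ht]
    push_cast
    ring
  · rw [abs_of_pos h, div_self ht]
    push_cast
    ring

lemma integral_tau_mul_Ek (hκ : 0 < κ) {f : ℝ → ℂ} (hf : Integrable f (mu κ)) (s y : ℝ) :
    ∫ t, tau κ s f t * Ek κ t (-Complex.I * y) ∂(mu κ) =
      Ek κ s (-Complex.I * y) * ∫ t, f t * Ek κ t (-Complex.I * y) ∂(mu κ) := by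
  rw [← integral_const_mul]
  rcases eq_or_ne s 0 with rfl | hs
  · have hac : mu κ ≪ volume := withDensity_absolutelyContinuous _ _
    refine integral_congr_ae ?_
    filter_upwards [hac.ae_le ae_ne_zero] with t ht
    rw [tau_zero ht f (-Complex.I * y), Complex.ofReal_zero, mul_assoc]
  · rw [integral_tau_mul hκ hs hf (stronglyMeasurable_Ek _) (fun t => norm_Ek_le t y)]
    refine integral_congr_ae (.of_forall fun t => ?_)
    simp only [tau_neg_Ek hκ]
    ring

end Duality

/-- `(τ_s f)^(y) = E(s,-iy) f̂(y)` for `f ∈ L¹(μ_κ)`. -/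
theorem dunkl_translation (κ : ℝ) (hκ : 0 < κ) (f : ℝ → ℂ) (hf : Integrable f (mu κ))
    (s y : ℝ) :
    dunkl κ (tau κ s f) y = Ek κ (s : ℂ) (-Complex.I * (y : ℂ)) * dunkl κ f y := by
  rw [dunkl, dunkl, integral_tau_mul_Ek hκ hf]
  ring
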